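/- arXiv:1709.10219 — 2 statements merged into one kernel-verified Lean document; each statement's English description precedes it below -/
import Mathlib

section
/- Let λ > 0, let M ∈ ℝ^{n×n} have nonnegative entries, and let p, q ∈ S_{n-1}. Let P*(p,p) and P*(p,q) be the (unique) minimizers of L_λ over U(p,p) and U(p,q) respectively. Then D_λ[p:q] = (λ/(1+λ)) KL[P*(p,p) : P*(p,q)] ≥ 0, and D_λ[p:q] = 0 if and only if p = q. -/
open Finset Real

/-- Membership in the probability simplex `S_{n-1}`: strictly positive entries summing to 1. -/
def IsSimplex {n : ℕ} (p : Fin n → ℝ) : Prop :=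
  (∀ i, 0 < p i) ∧ ∑ i, p i = 1

/-- `P ∈ U(p,q)`: a transportation plan with marginals `p` (rows) and `q` (columns). -/
def IsPlan {n : ℕ} (p q : Fin n → ℝ) (P : Matrix (Fin n) (Fin n) ℝ) : Prop :=
  (∀ i j, 0 ≤ P i j) ∧ (∀ i, ∑ j, P i j = p i) ∧ (∀ j, ∑ i, P i j = q j)

/-- Entropy of a plan, `H(P) = -Σ P_ij log P_ij` (with `0 log 0 = 0`). -/
noncomputable def entM {n : ℕ} (P : Matrix (Fin n) (Fin n) ℝ) : ℝ :=
  -∑ i, ∑ j, P i j * Real.log (P i j)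

/-- Entropy of a probability vector. -/
noncomputable def entV {n : ℕ} (p : Fin n → ℝ) : ℝ :=
  -∑ i, p i * Real.log (p i)

/-- Transportation cost `⟨M, P⟩ = Σ m_ij P_ij`. -/
noncomputable def cost {n : ℕ} (M P : Matrix (Fin n) (Fin n) ℝ) : ℝ :=
  ∑ i, ∑ j, M i j * P i j

/-- KL-divergence between two matrices (finite-valued formula, `0 log 0 = 0`). -/
noncomputable def klM {n : ℕ} (P Q : Matrix (Fin n) (Fin n) ℝ) : ℝ :=
  ∑ i, ∑ j, P i j * Real.log (P i j / Q i j)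

/-- The entropy-relaxed transportation objective
`L_λ(P) = (1/(1+λ))⟨M,P⟩ - (λ/(1+λ)) H(P)`. -/
noncomputable def Lfun {n : ℕ} (lam : ℝ) (M P : Matrix (Fin n) (Fin n) ℝ) : ℝ :=
  (1 / (1 + lam)) * cost M P - (lam / (1 + lam)) * entM P

/-- The Cuturi function `C_λ(p,q) = min_{P ∈ U(p,q)} L_λ(P)` (as an infimum, which is
attained on the compact set `U(p,q)`). -/
noncomputable def Cfun {n : ℕ} (lam : ℝ) (M : Matrix (Fin n) (Fin n) ℝ)
    (p q : Fin n → ℝ) : ℝ :=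
  sInf {x | ∃ P : Matrix (Fin n) (Fin n) ℝ, IsPlan p q P ∧ x = Lfun lam M P}

theorem Lfun_eq {n : ℕ} (lam : ℝ) (M P : Matrix (Fin n) (Fin n) ℝ) :
    Lfun lam M P = ∑ x : Fin n × Fin n, ((1 / (1 + lam)) * (M x.1 x.2 * P x.1 x.2)
      + (lam / (1 + lam)) * (P x.1 x.2 * Real.log (P x.1 x.2))) := by
  unfold Lfun cost entM
  rw [Finset.sum_add_distrib, ← Finset.mul_sum, ← Finset.mul_sum,
    Fintype.sum_prod_type, Fintype.sum_prod_type]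
  ring

/-- Linear combination of two plans. -/
noncomputable def mixM {n : ℕ} (s t : ℝ) (P Q : Matrix (Fin n) (Fin n) ℝ) :
    Matrix (Fin n) (Fin n) ℝ := fun i j => s * P i j + t * Q i j

theorem mixM_apply {n : ℕ} (s t : ℝ) (P Q : Matrix (Fin n) (Fin n) ℝ) (i j : Fin n) :
    mixM s t P Q i j = s * P i j + t * Q i j := rfl

theorem plan_comb {n : ℕ} {p q : Fin n → ℝ} {P Q : Matrix (Fin n) (Fin n) ℝ}
    (hP : IsPlan p q P) (hQ : IsPlan p q Q) {s t : ℝ} (hs : 0 ≤ s) (ht : 0 ≤ t)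
    (hst : s + t = 1) : IsPlan p q (mixM s t P Q) := by
  unfold mixM
  refine ⟨fun i j => ?_, fun i => ?_, fun j => ?_⟩
  · have := hP.1 i j
    have := hQ.1 i j
    positivity
  · rw [Finset.sum_add_distrib, ← Finset.mul_sum, ← Finset.mul_sum, hP.2.1, hQ.2.1, ← add_mul,
      hst, one_mul]
  · rw [Finset.sum_add_distrib, ← Finset.mul_sum, ← Finset.mul_sum, hP.2.2, hQ.2.2, ← add_mul,
      hst, one_mul]

theorem plan_pos {n : ℕ} (lam : ℝ) (hlam : 0 < lam)
    (M : Matrix (Fin n) (Fin n) ℝ)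
    (p q : Fin n → ℝ) (hp : IsSimplex p) (hq : IsSimplex q)
    (P : Matrix (Fin n) (Fin n) ℝ) (hP : IsPlan p q P)
    (hmin : ∀ Q : Matrix (Fin n) (Fin n) ℝ, IsPlan p q Q → Lfun lam M P ≤ Lfun lam M Q)
    (i j : Fin n) : 0 < P i j := by
  rcases (hP.1 i j).lt_or_eq with h | h
  · exact h
  exfalso
  set R : Matrix (Fin n) (Fin n) ℝ := fun i j => p i * q j with hR
  have hRpos : ∀ i j, 0 < R i j := fun i j => mul_pos (hp.1 i) (hq.1 j)
  have hRp : IsPlan p q R := by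
    refine ⟨fun i j => (hRpos i j).le, fun i => ?_, fun j => ?_⟩
    · simp only [hR]
      rw [← Finset.mul_sum, hq.2, mul_one]
    · simp only [hR]
      rw [← Finset.sum_mul, hp.2, one_mul]
  have hc : 0 < lam / (1 + lam) := by positivity
  set c := lam / (1 + lam) with hcdef
  have key : ∀ t : ℝ, 0 < t → t ≤ 1 →
      Lfun lam M P ≤ (1 - t) * Lfun lam M P + t * Lfun lam M R + c * (t * R i j * Real.log t) := by
    intro t ht ht1
    refine (hmin _ (plan_comb hP hRp (sub_nonneg.2 ht1) ht.le (by ring))).trans ?_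
    have e : c * (t * R i j * Real.log t) = ∑ x : Fin n × Fin n,
        if x = (i, j) then c * (t * R i j * Real.log t) else 0 := by simp
    rw [Lfun_eq, Lfun_eq, Lfun_eq, e, Finset.mul_sum, Finset.mul_sum, ← Finset.sum_add_distrib,
      ← Finset.sum_add_distrib]
    apply Finset.sum_le_sum
    rintro ⟨a, b⟩ -
    simp only [mixM_apply]
    by_cases hab : (a, b) = (i, j)
    · obtain ⟨rfl, rfl⟩ := Prod.mk.inj hab
      simp only [if_true, ← h]
      rw [show (1 - t) * 0 + t * R a b = t * R a b by ring,
        Real.log_mul ht.ne' (hRpos a b).ne']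
      apply le_of_eq
      simp only [← hcdef]
      ring
    · rw [if_neg hab]
      have := Real.convexOn_mul_log.2 (Set.mem_Ici.2 (hP.1 a b)) (Set.mem_Ici.2 (hRpos a b).le)
        (sub_nonneg.2 ht1) ht.le (by ring)
      simp only [smul_eq_mul] at this
      have := mul_le_mul_of_nonneg_left this hc.le
      simp only [← hcdef]
      linarith
  set r := R i j
  have hr : 0 < r := hRpos i j
  set K := |Lfun lam M R - Lfun lam M P| / (c * r) + 1 with hK
  have hKp : 0 < K := by positivity
  have h1 := key (Real.exp (-K)) (Real.exp_pos _) (Real.exp_le_one_iff.2 (by linarith))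
  rw [Real.log_exp] at h1
  have h2 : 0 ≤ Real.exp (-K) * ((Lfun lam M R - Lfun lam M P) - c * r * K) := by linarith
  have h3 := nonneg_of_mul_nonneg_right h2 (Real.exp_pos _)
  have h4 : c * r * K = |Lfun lam M R - Lfun lam M P| + c * r := by
    rw [hK]; field_simp
  have := le_abs_self (Lfun lam M R - Lfun lam M P)
  have := mul_pos hc hr
  linarith

theorem plan_unique {n : ℕ} (lam : ℝ) (hlam : 0 < lam)
    (M : Matrix (Fin n) (Fin n) ℝ) (p q : Fin n → ℝ)
    (P Q : Matrix (Fin n) (Fin n) ℝ) (hP : IsPlan p q P) (hQ : IsPlan p q Q)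
    (hminP : ∀ Q : Matrix (Fin n) (Fin n) ℝ, IsPlan p q Q → Lfun lam M P ≤ Lfun lam M Q)
    (hminQ : ∀ P : Matrix (Fin n) (Fin n) ℝ, IsPlan p q P → Lfun lam M Q ≤ Lfun lam M P) :
    P = Q := by
  by_contra hne
  obtain ⟨i, j, hij⟩ : ∃ i j, P i j ≠ Q i j := by
    by_contra! h
    exact hne (Matrix.ext h)
  have hc : 0 < lam / (1 + lam) := by positivity
  have h0 : (0:ℝ) ≤ 1 / 2 := by norm_num
  have h1 : Lfun lam M (mixM (1 / 2) (1 / 2) P Q)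
      < 1 / 2 * Lfun lam M P + 1 / 2 * Lfun lam M Q := by
    rw [Lfun_eq, Lfun_eq, Lfun_eq, Finset.mul_sum, Finset.mul_sum, ← Finset.sum_add_distrib]
    apply Finset.sum_lt_sum
    · rintro ⟨a, b⟩ -
      have := Real.convexOn_mul_log.2 (Set.mem_Ici.2 (hP.1 a b)) (Set.mem_Ici.2 (hQ.1 a b))
        h0 h0 (by norm_num)
      simp only [smul_eq_mul] at this
      have := mul_le_mul_of_nonneg_left this hc.le
      simp only [mixM_apply]
      linarith
    · refine ⟨(i, j), Finset.mem_univ _, ?_⟩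
      have := Real.strictConvexOn_mul_log.2 (Set.mem_Ici.2 (hP.1 i j)) (Set.mem_Ici.2 (hQ.1 i j))
        hij (show (0:ℝ) < 1 / 2 by norm_num) (show (0:ℝ) < 1 / 2 by norm_num) (by norm_num)
      simp only [smul_eq_mul] at this
      have := mul_lt_mul_of_pos_left this hc
      simp only [mixM_apply]
      linarith
  have h2 := hminP _ (plan_comb hP hQ h0 h0 (by norm_num))
  have h3 := hminQ _ (plan_comb hP hQ h0 h0 (by norm_num))
  linarith

theorem kl_term_lt {x y : ℝ} (hx : 0 < x) (hy : 0 < y) (h : x ≠ y) :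
    x - y < x * Real.log (x / y) := by
  have h1 : y / x ≠ 1 := by
    intro h2
    rw [div_eq_one_iff_eq hx.ne'] at h2
    exact h h2.symm
  have h2 := mul_lt_mul_of_pos_left (Real.log_lt_sub_one_of_pos (div_pos hy hx) h1) hx
  rw [← inv_div x y, Real.log_inv, inv_div, mul_sub, mul_div_cancel₀ _ hx.ne'] at h2
  linarith

theorem kl_term_le {x y : ℝ} (hx : 0 < x) (hy : 0 < y) :
    x - y ≤ x * Real.log (x / y) := by
  by_cases h : x = y
  · subst h
    simp [hx.ne']
  · exact (kl_term_lt hx hy h).le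

/-- `D_λ[p:q] = (λ/(1+λ)) KL[P*(p,p) : P*(p,q)] ≥ 0`, with equality
iff `p = q`. -/
theorem stmt9 {n : ℕ} (hn : 2 ≤ n) (lam : ℝ) (hlam : 0 < lam)
    (M : Matrix (Fin n) (Fin n) ℝ) (hM : ∀ i j, 0 ≤ M i j)
    (p q : Fin n → ℝ) (hp : IsSimplex p) (hq : IsSimplex q)
    (Ppp Ppq : Matrix (Fin n) (Fin n) ℝ)
    (hPpp : IsPlan p p Ppp)
    (hminpp : ∀ Q : Matrix (Fin n) (Fin n) ℝ, IsPlan p p Q → Lfun lam M Ppp ≤ Lfun lam M Q)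
    (hPpq : IsPlan p q Ppq)
    (hminpq : ∀ Q : Matrix (Fin n) (Fin n) ℝ, IsPlan p q Q → Lfun lam M Ppq ≤ Lfun lam M Q) :
    0 ≤ (lam / (1 + lam)) * klM Ppp Ppq ∧
      ((lam / (1 + lam)) * klM Ppp Ppq = 0 ↔ p = q) := by
  have hc : 0 < lam / (1 + lam) := by positivity
  have pos1 := plan_pos lam hlam M p p hp hp Ppp hPpp hminpp
  have pos2 := plan_pos lam hlam M p q hp hq Ppq hPpq hminpq
  have hS : ∑ x : Fin n × Fin n, (Ppp x.1 x.2 - Ppq x.1 x.2) = 0 := by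
    rw [Finset.sum_sub_distrib, Fintype.sum_prod_type, Fintype.sum_prod_type]
    simp only [hPpp.2.1, hPpq.2.1, sub_self]
  have hkl : klM Ppp Ppq
      = ∑ x : Fin n × Fin n, Ppp x.1 x.2 * Real.log (Ppp x.1 x.2 / Ppq x.1 x.2) := by
    rw [Fintype.sum_prod_type]
    rfl
  have hnn : 0 ≤ klM Ppp Ppq := by
    rw [hkl, ← hS]
    exact Finset.sum_le_sum fun x _ => kl_term_le (pos1 _ _) (pos2 _ _)
  refine ⟨mul_nonneg hc.le hnn, fun h => ?_, fun h => ?_⟩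
  · have h0 : klM Ppp Ppq = 0 := (mul_eq_zero.1 h).resolve_left hc.ne'
    have heq : ∀ i j, Ppp i j = Ppq i j := by
      intro i j
      by_contra hij
      have : (0:ℝ) < klM Ppp Ppq := by
        rw [hkl, ← hS]
        exact Finset.sum_lt_sum (fun x _ => kl_term_le (pos1 _ _) (pos2 _ _))
          ⟨(i, j), Finset.mem_univ _, kl_term_lt (pos1 _ _) (pos2 _ _) hij⟩
      linarith
    funext j
    rw [← hPpp.2.2 j, ← hPpq.2.2 j]
    exact Finset.sum_congr rfl fun i _ => heq i j
  · subst h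
    have := plan_unique lam hlam M p p Ppp Ppq hPpp hPpq hminpp hminpq
    subst this
    rw [hkl]
    simp [fun i j => div_self (pos1 i j).ne']
end

section
/- Let M ∈ ℝ^{n×n} have nonnegative entries and let p, q ∈ S_{n-1}. For λ > 0 let P*_λ(p,p) and P*_λ(p,q) denote the unique minimizers of L_λ over U(p,p) and U(p,q) respectively. Then lim_{λ → ∞} KL[P*_λ(p,p) : P*_λ(p,q)] = KL[p:q] = Σ_i p_i log(p_i/q_i). -/
open Finset Real

theorem aux_pt {P Q : ℝ} (hP : 0 ≤ P) (hQ : 0 < Q) :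
    (√P - √Q) ^ 2 ≤ P * Real.log P - P * Real.log Q - P + Q := by
  obtain ⟨a, ha, rfl⟩ : ∃ a : ℝ, 0 ≤ a ∧ P = a ^ 2 := ⟨√P, Real.sqrt_nonneg _, (Real.sq_sqrt hP).symm⟩
  obtain ⟨b, hb, rfl⟩ : ∃ b : ℝ, 0 < b ∧ Q = b ^ 2 :=
    ⟨√Q, Real.sqrt_pos.2 hQ, (Real.sq_sqrt hQ.le).symm⟩
  rw [Real.sqrt_sq ha, Real.sqrt_sq hb.le]
  rcases ha.eq_or_lt with h | h
  · subst h; simp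
  · have h1 := Real.log_le_sub_one_of_pos (div_pos hb h)
    rw [Real.log_div hb.ne' h.ne'] at h1
    have h2 := mul_le_mul_of_nonneg_left h1 (sq_nonneg a)
    have h3 : a ^ 2 * (b / a - 1) = a * b - a ^ 2 := by field_simp
    rw [h3] at h2
    rw [Real.log_pow, Real.log_pow]
    push_cast
    nlinarith

theorem aux_sum {n : ℕ} {p q : Fin n → ℝ} {R : Matrix (Fin n) (Fin n) ℝ} (hR : IsPlan p q R)
    (f g : Fin n → ℝ) :
    ∑ i, ∑ j, R i j * (f i + g j) = ∑ i, p i * f i + ∑ j, q j * g j := by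
  simp only [mul_add, Finset.sum_add_distrib]
  congr 1
  · simp only [← Finset.sum_mul, hR.2.1]
  · rw [Finset.sum_comm]
    simp only [← Finset.sum_mul, hR.2.2]

theorem aux_prod {n : ℕ} {p q : Fin n → ℝ} (hp : IsSimplex p) (hq : IsSimplex q) :
    IsPlan p q (fun i j => p i * q j) := by
  refine ⟨fun i j => (mul_pos (hp.1 i) (hq.1 j)).le, fun i => ?_, fun j => ?_⟩
  · rw [← Finset.mul_sum, hq.2, mul_one]
  · rw [← Finset.sum_mul, hp.2, one_mul]

theorem aux_bound {n : ℕ} {M : Matrix (Fin n) (Fin n) ℝ} (hM : ∀ i j, 0 ≤ M i j)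
    {p q : Fin n → ℝ} (hp : IsSimplex p) (hq : IsSimplex q) {P : Matrix (Fin n) (Fin n) ℝ}
    (hP : IsPlan p q P) {lam : ℝ} (hl : 0 < lam)
    (hmin : Lfun lam M P ≤ Lfun lam M (fun i j => p i * q j)) (i j : Fin n) :
    (√(P i j) - √(p i * q j)) ^ 2 ≤ cost M (fun i j => p i * q j) / lam := by
  have hQ := aux_prod hp hq
  have hc : 0 ≤ cost M P :=
    Finset.sum_nonneg fun i _ => Finset.sum_nonneg fun j _ => mul_nonneg (hM i j) (hP.1 i j)
  have h1 : entM (fun i j => p i * q j) - entM P ≤ cost M (fun i j => p i * q j) / lam := by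
    rw [le_div_iff₀ hl]
    unfold Lfun at hmin
    have h2 := mul_le_mul_of_nonneg_left hmin (by positivity : 0 ≤ 1 + lam)
    have h3 : ∀ x y : ℝ, (1 + lam) * (1 / (1 + lam) * x - lam / (1 + lam) * y) = x - lam * y := by
      intro x y; field_simp
    rw [h3, h3] at h2
    nlinarith
  refine le_trans ?_ h1
  have hlog : ∀ i j, Real.log (p i * q j) = Real.log (p i) + Real.log (q j) := fun i j =>
    Real.log_mul (hp.1 i).ne' (hq.1 j).ne'
  have e1 := aux_sum hP (fun i => Real.log (p i)) (fun j => Real.log (q j))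
  have e2 := aux_sum hQ (fun i => Real.log (p i)) (fun j => Real.log (q j))
  have e3 : ∑ i, ∑ j, P i j = 1 := by simp only [hP.2.1, hp.2]
  have e4 : ∑ i, ∑ j, p i * q j = 1 := by
    have := hQ.2.1
    simp only at this
    simp only [this, hp.2]
  have e5 : entM (fun i j => p i * q j) - entM P = ∑ i, ∑ j,
      (P i j * Real.log (P i j) - P i j * Real.log (p i * q j) - P i j + p i * q j) := by
    simp only [Finset.sum_add_distrib, Finset.sum_sub_distrib, entM, hlog, e1, e2, e3, e4]
    ring
  rw [e5]
  have hnn : ∀ i j, (√(P i j) - √(p i * q j)) ^ 2 ≤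
      P i j * Real.log (P i j) - P i j * Real.log (p i * q j) - P i j + p i * q j := fun i j =>
    aux_pt (hP.1 i j) (mul_pos (hp.1 i) (hq.1 j))
  have hnn' := fun i j => (sq_nonneg _).trans (hnn i j)
  refine (hnn i j).trans ?_
  refine (Finset.single_le_sum (f := fun j => P i j * Real.log (P i j) - P i j * Real.log (p i * q j) - P i j + p i * q j)
    (fun j _ => hnn' i j) (Finset.mem_univ j)).trans ?_
  exact Finset.single_le_sum (f := fun i => ∑ j, (P i j * Real.log (P i j) - P i j * Real.log (p i * q j) - P i j + p i * q j))
    (fun i _ => Finset.sum_nonneg fun j _ => hnn' i j) (Finset.mem_univ i)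

theorem aux_tendsto {n : ℕ} {M : Matrix (Fin n) (Fin n) ℝ} (hM : ∀ i j, 0 ≤ M i j)
    {p q : Fin n → ℝ} (hp : IsSimplex p) (hq : IsSimplex q) {P : ℝ → Matrix (Fin n) (Fin n) ℝ}
    (h : ∀ lam : ℝ, 0 < lam → IsPlan p q (P lam) ∧
      ∀ Q : Matrix (Fin n) (Fin n) ℝ, IsPlan p q Q → Lfun lam M (P lam) ≤ Lfun lam M Q)
    (i j : Fin n) :
    Filter.Tendsto (fun lam => P lam i j) Filter.atTop (nhds (p i * q j)) := by
  have hpos := mul_pos (hp.1 i) (hq.1 j)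
  have h1 : Filter.Tendsto (fun lam => (√(P lam i j) - √(p i * q j)) ^ 2) Filter.atTop (nhds 0) := by
    refine squeeze_zero' (Filter.Eventually.of_forall fun _ => sq_nonneg _) ?_
      (tendsto_const_nhds.div_atTop Filter.tendsto_id (a := cost M (fun i j => p i * q j)))
    filter_upwards [Filter.eventually_gt_atTop 0] with lam hl
    exact aux_bound hM hp hq (h lam hl).1 hl ((h lam hl).2 _ (aux_prod hp hq)) i j
  have h2 := h1.sqrt
  simp only [Real.sqrt_sq_eq_abs, Real.sqrt_zero] at h2
  have h3 := (tendsto_zero_iff_abs_tendsto_zero _).2 h2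
  have h4 := (h3.add_const (√(p i * q j))).pow 2
  rw [zero_add, Real.sq_sqrt hpos.le] at h4
  refine h4.congr' ?_
  filter_upwards [Filter.eventually_gt_atTop 0] with lam hl
  simp [Real.sq_sqrt ((h lam hl).1.1 i j)]

/-- `lim_{λ → ∞} KL[P*_λ(p,p) : P*_λ(p,q)] = KL[p:q] = Σ p_i log(p_i/q_i)`. -/
theorem stmt11 {n : ℕ} (hn : 2 ≤ n)
    (M : Matrix (Fin n) (Fin n) ℝ) (hM : ∀ i j, 0 ≤ M i j)
    (p q : Fin n → ℝ) (hp : IsSimplex p) (hq : IsSimplex q)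
    (Ppp Ppq : ℝ → Matrix (Fin n) (Fin n) ℝ)
    (hPpp : ∀ lam : ℝ, 0 < lam → IsPlan p p (Ppp lam) ∧
      ∀ Q : Matrix (Fin n) (Fin n) ℝ, IsPlan p p Q →
        Lfun lam M (Ppp lam) ≤ Lfun lam M Q)
    (hPpq : ∀ lam : ℝ, 0 < lam → IsPlan p q (Ppq lam) ∧
      ∀ Q : Matrix (Fin n) (Fin n) ℝ, IsPlan p q Q →
        Lfun lam M (Ppq lam) ≤ Lfun lam M Q) :
    Filter.Tendsto (fun lam => klM (Ppp lam) (Ppq lam)) Filter.atTop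
      (nhds (∑ i, p i * Real.log (p i / q i))) := by
  have hlim : ∑ i, p i * Real.log (p i / q i) =
      ∑ i, ∑ j, (p i * p j) * Real.log ((p i * p j) / (p i * q j)) := by
    rw [Finset.sum_comm]
    refine Finset.sum_congr rfl fun j _ => ?_
    have : ∀ i, (p i * p j) * Real.log ((p i * p j) / (p i * q j)) =
        p i * (p j * Real.log (p j / q j)) := fun i => by
      rw [mul_div_mul_left _ _ (hp.1 i).ne', mul_assoc]
    simp only [this]
    rw [← Finset.sum_mul, hp.2, one_mul]
  rw [hlim]
  unfold klM
  refine tendsto_finsetSum _ fun i _ => tendsto_finsetSum _ fun j _ => ?_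
  have h1 := aux_tendsto hM hp hp hPpp i j
  have h2 := aux_tendsto hM hp hq hPpq i j
  have a := mul_pos (hp.1 i) (hp.1 j)
  have b := mul_pos (hp.1 i) (hq.1 j)
  exact h1.mul ((h1.div h2 b.ne').log (div_pos a b).ne')
end
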